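/- arXiv:1904.04813 — 3 statements merged into one kernel-verified Lean document; each statement's English description precedes it below -/
import Mathlib

section
/- For every ℓ ∈ ℤ and every integer k with 1 ≤ k ≤ 2δ+1, the covariance of W_ℓ and W_{ℓ+k} satisfies Cov(W_ℓ, W_{ℓ+k}) = (2δ − k + 1) p_X² p_Y (1 − p_Y). -/
open MeasureTheory ProbabilityTheory

lemma int_prod_aux {Ω : Type*} [MeasurableSpace Ω] (μ : Measure Ω) [IsProbabilityMeasure μ]
    (f : ℤ ⊕ ℤ → Ω → ℝ) (hf : ∀ i, Measurable (f i)) (hind : iIndepFun f μ)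
    (s : Finset (ℤ ⊕ ℤ)) :
    ∫ ω, ∏ i ∈ s, f i ω ∂μ = ∏ i ∈ s, ∫ ω, f i ω ∂μ := by
  classical
  induction s using Finset.induction_on with
  | empty => simp
  | insert a s ha ih =>
    have h1 := (hind.indepFun_finsetProd_of_notMem hf ha).symm
    have h2 := h1.integral_mul_eq_mul_integral (hf a).aestronglyMeasurable
      (by
        have := Finset.measurable_prod s (fun i _ => hf i)
        convert this.aestronglyMeasurable using 1
        ext ω
        simp [Finset.prod_apply])
    simp only [Finset.prod_insert ha]
    rw [← ih]
    simpa [Finset.prod_apply] using h2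

lemma int_01_aux {Ω : Type*} [MeasurableSpace Ω] (μ : Measure Ω) (p : ℝ) (hp : 0 ≤ p)
    (f : Ω → ℝ) (hf : Measurable f) (h01 : ∀ ω, f ω = 0 ∨ f ω = 1)
    (h : μ {ω | f ω = 1} = ENNReal.ofReal p) : ∫ ω, f ω ∂μ = p := by
  have hm : MeasurableSet {ω | f ω = 1} := hf (measurableSet_singleton 1)
  have : f = Set.indicator {ω | f ω = 1} (fun _ => (1 : ℝ)) := by
    funext ω
    rcases h01 ω with h | h <;> simp [Set.indicator, h]
  rw [this, integral_indicator_const _ hm]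
  simp [measureReal_def, h, hp]

lemma count_aux (δ : ℕ) (ℓ k : ℤ) (hk1 : 1 ≤ k) (hk2 : k ≤ 2 * (δ : ℤ) + 1) (c : ℝ) :
    ∑ i ∈ Finset.Icc (-(δ : ℤ)) (δ : ℤ), ∑ j ∈ Finset.Icc (-(δ : ℤ)) (δ : ℤ),
      (if ℓ + i = ℓ + k + j then c else 0) = (2 * (δ : ℝ) - (k : ℝ) + 1) * c := by
  have h1 : ∀ i ∈ Finset.Icc (-(δ : ℤ)) (δ : ℤ), ∑ j ∈ Finset.Icc (-(δ : ℤ)) (δ : ℤ),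
      (if ℓ + i = ℓ + k + j then c else 0) = if k - δ ≤ i then c else 0 := by
    intro i hi
    have : ∀ j, (ℓ + i = ℓ + k + j) ↔ (i - k = j) := fun j => by omega
    simp only [this, Finset.sum_ite_eq, Finset.mem_Icc] at hi ⊢
    congr 1
    apply propext
    omega
  rw [Finset.sum_congr rfl h1, ← Finset.sum_filter]
  have h2 : (Finset.Icc (-(δ : ℤ)) (δ : ℤ)).filter (fun i => k - δ ≤ i)
      = Finset.Icc (k - δ) δ := by
    ext i
    simp only [Finset.mem_filter, Finset.mem_Icc]
    omega
  rw [h2, Finset.sum_const, Int.card_Icc, nsmul_eq_mul]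
  congr 1
  have : (((δ + 1 - (k - δ) : ℤ).toNat : ℤ) : ℝ) = ((δ + 1 - (k - δ) : ℤ) : ℝ) := by
    rw [Int.toNat_of_nonneg (by omega)]
  push_cast at this
  rw [this]
  ring

/-- For every `ℓ ∈ ℤ` and every integer `k` with `1 ≤ k ≤ 2δ+1`, the covariance of
`W ℓ` and `W (ℓ+k)` satisfies `Cov(W ℓ, W (ℓ+k)) = (2δ − k + 1) p_X² p_Y (1 − p_Y)`,
where `W i = X i · ∑_{j=−δ}^{δ} Y (i+j)` and the `X i`, `Y j` (`i, j ∈ ℤ`) are mutually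
independent `{0,1}`-valued random variables, each `X i` Bernoulli(`pX`) and each `Y j`
Bernoulli(`pY`). The covariance is written as `E(W_ℓ W_{ℓ+k}) − E(W_ℓ) E(W_{ℓ+k})`. -/
theorem covariance_W
    {Ω : Type*} [MeasurableSpace Ω] (μ : Measure Ω) [IsProbabilityMeasure μ]
    (pX pY : ℝ) (hpX : pX ∈ Set.Icc (0 : ℝ) 1) (hpY : pY ∈ Set.Icc (0 : ℝ) 1)
    (δ : ℕ)
    (X Y : ℤ → Ω → ℝ)
    (hXmeas : ∀ i, Measurable (X i)) (hYmeas : ∀ j, Measurable (Y j))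
    (hX01 : ∀ i ω, X i ω = 0 ∨ X i ω = 1) (hY01 : ∀ j ω, Y j ω = 0 ∨ Y j ω = 1)
    (hindep : iIndepFun (m := fun _ : ℤ ⊕ ℤ => Real.measurableSpace) (Sum.elim X Y) μ)
    (hXp : ∀ i, μ {ω | X i ω = 1} = ENNReal.ofReal pX)
    (hYp : ∀ j, μ {ω | Y j ω = 1} = ENNReal.ofReal pY)
    (W : ℤ → Ω → ℝ)
    (hW : ∀ i ω, W i ω = X i ω * ∑ j ∈ Finset.Icc (-(δ : ℤ)) (δ : ℤ), Y (i + j) ω)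
    (ℓ : ℤ) (k : ℤ) (hk1 : 1 ≤ k) (hk2 : k ≤ 2 * (δ : ℤ) + 1) :
    (∫ ω, W ℓ ω * W (ℓ + k) ω ∂μ) - (∫ ω, W ℓ ω ∂μ) * (∫ ω, W (ℓ + k) ω ∂μ)
      = (2 * (δ : ℝ) - (k : ℝ) + 1) * pX ^ 2 * pY * (1 - pY) := by
  have hm : ∀ i, Measurable (Sum.elim X Y i) := by
    rintro (i | i)
    · exact hXmeas i
    · exact hYmeas i
  have hIP := int_prod_aux μ (Sum.elim X Y) hm hindep
  have hEX : ∀ i, ∫ ω, X i ω ∂μ = pX := fun i =>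
    int_01_aux μ pX hpX.1 _ (hXmeas i) (hX01 i) (hXp i)
  have hEY : ∀ i, ∫ ω, Y i ω ∂μ = pY := fun i =>
    int_01_aux μ pY hpY.1 _ (hYmeas i) (hY01 i) (hYp i)
  have hXY : ∀ i a, ∫ ω, X i ω * Y a ω ∂μ = pX * pY := by
    intro i a
    have := hIP {Sum.inl i, Sum.inr a}
    simpa [hEX, hEY] using this
  have hXXY : ∀ i j a, i ≠ j → ∫ ω, X i ω * (X j ω * Y a ω) ∂μ = pX * (pX * pY) := by
    intro i j a hij
    have := hIP {Sum.inl i, Sum.inl j, Sum.inr a}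
    simpa [hEX, hEY, Finset.prod_insert, hij] using this
  have hXXYY : ∀ i j a b, i ≠ j → a ≠ b →
      ∫ ω, X i ω * (X j ω * (Y a ω * Y b ω)) ∂μ = pX * (pX * (pY * pY)) := by
    intro i j a b hij hab
    have := hIP {Sum.inl i, Sum.inl j, Sum.inr a, Sum.inr b}
    simpa [hEX, hEY, Finset.prod_insert, hij, hab] using this
  have hInteg : ∀ f : Ω → ℝ, Measurable f → (∀ ω, f ω = 0 ∨ f ω = 1) → Integrable f μ := by
    intro f hf h
    refine Integrable.of_bound hf.aestronglyMeasurable 1 (Filter.Eventually.of_forall fun ω => ?_)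
    rcases h ω with h | h <;> simp [h]
  have hEW : ∀ i, ∫ ω, W i ω ∂μ = (2 * δ + 1) * (pX * pY) := by
    intro i
    simp only [hW, Finset.mul_sum]
    rw [integral_finsetSum]
    · simp only [hXY, Finset.sum_const, Int.card_Icc, nsmul_eq_mul]
      congr 1
      have : ((δ : ℤ) + 1 - -(δ : ℤ)).toNat = 2 * δ + 1 := by omega
      rw [this]
      push_cast
      ring
    · intro j _
      refine hInteg _ ((hXmeas _).mul (hYmeas _)) fun ω => ?_
      rcases hX01 i ω with h | h <;> rcases hY01 (i + j) ω with h' | h' <;> simp [h, h']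
  have hterm : ∀ a b, ∫ ω, X ℓ ω * (X (ℓ + k) ω * (Y a ω * Y b ω)) ∂μ
      = pX ^ 2 * pY ^ 2 + if a = b then pX ^ 2 * pY * (1 - pY) else 0 := by
    intro a b
    by_cases hab : a = b
    · subst hab
      have : ∀ ω, Y a ω * Y a ω = Y a ω := fun ω => by
        rcases hY01 a ω with h | h <;> simp [h]
      simp only [this, if_true]
      rw [hXXY _ _ _ (by omega)]
      ring
    · rw [hXXYY _ _ _ _ (by omega) hab, if_neg hab]
      ring
  have hi4 : ∀ a b, Integrable (fun ω => X ℓ ω * (X (ℓ + k) ω * (Y a ω * Y b ω))) μ := by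
    intro a b
    refine hInteg _ ((hXmeas _).mul ((hXmeas _).mul ((hYmeas _).mul (hYmeas _)))) fun ω => ?_
    rcases hX01 ℓ ω with h1 | h1 <;> rcases hX01 (ℓ + k) ω with h2 | h2 <;>
      rcases hY01 a ω with h3 | h3 <;> rcases hY01 b ω with h4 | h4 <;> simp [h1, h2, h3, h4]
  have hWW : ∀ ω, W ℓ ω * W (ℓ + k) ω
      = ∑ i ∈ Finset.Icc (-(δ : ℤ)) (δ : ℤ), ∑ j ∈ Finset.Icc (-(δ : ℤ)) (δ : ℤ),
        X ℓ ω * (X (ℓ + k) ω * (Y (ℓ + i) ω * Y (ℓ + k + j) ω)) := by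
    intro ω
    simp only [← Finset.mul_sum]
    rw [← Finset.sum_mul, hW, hW]
    ring
  simp only [hWW, hEW]
  rw [integral_finsetSum _ (fun i _ => integrable_finsetSum _ fun j _ => hi4 _ _)]
  have h5 : ∀ i, ∫ ω, ∑ j ∈ Finset.Icc (-(δ : ℤ)) (δ : ℤ),
        X ℓ ω * (X (ℓ + k) ω * (Y (ℓ + i) ω * Y (ℓ + k + j) ω)) ∂μ
      = ∑ j ∈ Finset.Icc (-(δ : ℤ)) (δ : ℤ),
        (pX ^ 2 * pY ^ 2 + if ℓ + i = ℓ + k + j then pX ^ 2 * pY * (1 - pY) else 0) := by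
    intro i
    rw [integral_finsetSum _ (fun j _ => hi4 _ _)]
    simp only [hterm]
  simp only [h5, Finset.sum_add_distrib]
  rw [count_aux δ ℓ k hk1 hk2]
  have : ((δ : ℤ) + 1 - -(δ : ℤ)).toNat = 2 * δ + 1 := by omega
  simp only [Finset.sum_const, Int.card_Icc, nsmul_eq_mul, this]
  push_cast
  ring
end

section
/- For every ℓ ∈ ℤ, the quantity σ_δ² := Var(W_ℓ) + 2·∑_{k=1}^{2δ+1} Cov(W_ℓ, W_{ℓ+k}) is given by σ_δ² = (2δ+1) p_X p_Y (1 − p_X p_Y) + 2δ(2δ+1) p_X p_Y (p_Y(1 − p_X) + p_X(1 − p_Y)). -/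
open MeasureTheory ProbabilityTheory

lemma sd_integral_01 {Ω : Type*} [MeasurableSpace Ω] (μ : Measure Ω)
    (p : ℝ) (hp : 0 ≤ p) (Z : Ω → ℝ) (hm : Measurable Z) (h01 : ∀ ω, Z ω = 0 ∨ Z ω = 1)
    (hZ : μ {ω | Z ω = 1} = ENNReal.ofReal p) : ∫ ω, Z ω ∂μ = p := by
  have hms : MeasurableSet {ω | Z ω = 1} := hm (measurableSet_singleton 1)
  have h : Z = Set.indicator {ω | Z ω = 1} (fun _ => (1 : ℝ)) := by
    funext ω
    rcases h01 ω with h | h <;> simp [Set.indicator, h]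
  have h2 : ∫ ω, Z ω ∂μ = ∫ ω, Set.indicator {ω | Z ω = 1} (fun _ => (1 : ℝ)) ω ∂μ := by
    rw [← h]
  rw [h2, integral_indicator hms]
  simp [Measure.real, hZ, hp]

lemma sd_integral_prod {Ω ι : Type*} [MeasurableSpace Ω] (μ : Measure Ω)
    (Z : ι → Ω → ℝ) (hm : ∀ i, Measurable (Z i))
    (hindep : iIndepFun Z μ) (S : Finset ι) :
    ∫ ω, ∏ i ∈ S, Z i ω ∂μ = ∏ i ∈ S, ∫ ω, Z i ω ∂μ := by
  have h := hindep.precomp (g := fun i : S => (i : ι)) Subtype.val_injective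
  have h2 := h.integral_fun_prod_eq_prod_integral (fun i => (hm i).aestronglyMeasurable)
  rw [← Finset.prod_coe_sort S (fun i => ∫ ω, Z i ω ∂μ), ← h2]
  congr 1
  funext ω
  exact (Finset.prod_coe_sort S (fun i => Z i ω)).symm

lemma sd_count (δ : ℕ) (k : ℤ) (h0 : 0 ≤ k) (h1 : k ≤ 2 * (δ : ℤ) + 1) (l : ℤ) (a b : ℝ) :
    ∑ i ∈ Finset.Icc (-(δ : ℤ)) (δ : ℤ), ∑ j ∈ Finset.Icc (-(δ : ℤ)) (δ : ℤ),
      (if l + i = l + k + j then a else b)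
      = (2 * (δ : ℝ) + 1) ^ 2 * b + (2 * (δ : ℝ) + 1 - k) * (a - b) := by
  have hc : ((Finset.Icc (-(δ : ℤ)) (δ : ℤ)).card : ℝ) = 2 * (δ : ℝ) + 1 := by
    rw [Int.card_Icc]
    have : ((δ : ℤ) + 1 - -(δ : ℤ)).toNat = 2 * δ + 1 := by omega
    rw [this]; push_cast; ring
  have e : ∀ i ∈ Finset.Icc (-(δ : ℤ)) (δ : ℤ), ∑ j ∈ Finset.Icc (-(δ : ℤ)) (δ : ℤ),
      (if l + i = l + k + j then a else b)
      = (2 * (δ : ℝ) + 1) * b + if i ∈ Finset.Icc (-(δ : ℤ) + k) (δ : ℤ) then a - b else 0 := by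
    intro i hi
    have : ∀ j ∈ Finset.Icc (-(δ : ℤ)) (δ : ℤ), (if l + i = l + k + j then a else b)
        = b + if i - k = j then a - b else 0 := by
      intro j _
      by_cases h : i - k = j
      · rw [if_pos h, if_pos (by omega)]; ring
      · rw [if_neg h, if_neg (by omega)]; ring
    rw [Finset.sum_congr rfl this, Finset.sum_add_distrib, Finset.sum_const, nsmul_eq_mul, hc,
      Finset.sum_ite_eq]
    congr 1
    rw [Finset.mem_Icc] at hi
    refine if_congr ?_ rfl rfl
    simp only [Finset.mem_Icc]
    omega
  rw [Finset.sum_congr rfl e, Finset.sum_add_distrib, Finset.sum_const, nsmul_eq_mul, hc,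
    Finset.sum_ite_mem, Finset.inter_eq_right.mpr (Finset.Icc_subset_Icc (by omega) le_rfl),
    Finset.sum_const, nsmul_eq_mul]
  have hc2 : ((Finset.Icc (-(δ : ℤ) + k) (δ : ℤ)).card : ℝ) = 2 * (δ : ℝ) + 1 - k := by
    rw [Int.card_Icc]
    have : ((((δ : ℤ) + 1 - (-(δ : ℤ) + k)).toNat : ℤ) : ℝ) = ((2 * (δ : ℤ) + 1 - k : ℤ) : ℝ) := by
      congr 1; omega
    push_cast at this
    exact_mod_cast this
  rw [hc2]; ring

lemma sd_gauss (n : ℕ) : ∑ k ∈ Finset.Icc (1 : ℤ) (n : ℤ), ((n : ℝ) - k) = n * (n - 1) / 2 := by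
  have h : ∀ m : ℕ, ∑ k ∈ Finset.Icc (1 : ℤ) (m : ℤ), ((n : ℝ) - k)
      = m * n - m * (m + 1) / 2 := by
    intro m
    induction m with
    | zero => simp
    | succ m ih =>
      have : Finset.Icc (1 : ℤ) ((m + 1 : ℕ) : ℤ) = insert ((m : ℤ) + 1) (Finset.Icc 1 (m : ℤ)) := by
        ext x; simp only [Finset.mem_Icc, Finset.mem_insert]; push_cast; omega
      rw [this, Finset.sum_insert (by simp), ih]
      push_cast; ring
  rw [h]; ring

/-- For every `ℓ ∈ ℤ`, the quantity
`σ_δ² := Var(W ℓ) + 2·∑_{k=1}^{2δ+1} Cov(W ℓ, W (ℓ+k))` is given by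
`σ_δ² = (2δ+1) p_X p_Y (1 − p_X p_Y) + 2δ(2δ+1) p_X p_Y (p_Y(1 − p_X) + p_X(1 − p_Y))`,
where `W i = X i · ∑_{j=−δ}^{δ} Y (i+j)` and the `X i`, `Y j` (`i, j ∈ ℤ`) are mutually
independent `{0,1}`-valued random variables, each `X i` Bernoulli(`pX`) and each `Y j`
Bernoulli(`pY`). Covariances are written as `E(W_ℓ W_{ℓ+k}) − E(W_ℓ) E(W_{ℓ+k})`. -/
theorem sigma_delta_squared
    {Ω : Type*} [MeasurableSpace Ω] (μ : Measure Ω) [IsProbabilityMeasure μ]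
    (pX pY : ℝ) (hpX : pX ∈ Set.Icc (0 : ℝ) 1) (hpY : pY ∈ Set.Icc (0 : ℝ) 1)
    (δ : ℕ)
    (X Y : ℤ → Ω → ℝ)
    (hXmeas : ∀ i, Measurable (X i)) (hYmeas : ∀ j, Measurable (Y j))
    (hX01 : ∀ i ω, X i ω = 0 ∨ X i ω = 1) (hY01 : ∀ j ω, Y j ω = 0 ∨ Y j ω = 1)
    (hindep : iIndepFun (m := fun _ : ℤ ⊕ ℤ => Real.measurableSpace) (Sum.elim X Y) μ)
    (hXp : ∀ i, μ {ω | X i ω = 1} = ENNReal.ofReal pX)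
    (hYp : ∀ j, μ {ω | Y j ω = 1} = ENNReal.ofReal pY)
    (W : ℤ → Ω → ℝ)
    (hW : ∀ i ω, W i ω = X i ω * ∑ j ∈ Finset.Icc (-(δ : ℤ)) (δ : ℤ), Y (i + j) ω)
    (ℓ : ℤ) :
    variance (W ℓ) μ
      + 2 * ∑ k ∈ Finset.Icc (1 : ℤ) (2 * (δ : ℤ) + 1),
          ((∫ ω, W ℓ ω * W (ℓ + k) ω ∂μ) - (∫ ω, W ℓ ω ∂μ) * (∫ ω, W (ℓ + k) ω ∂μ))
      = (2 * (δ : ℝ) + 1) * pX * pY * (1 - pX * pY)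
        + 2 * (δ : ℝ) * (2 * (δ : ℝ) + 1) * pX * pY * (pY * (1 - pX) + pX * (1 - pY)) := by
  classical
  have hZm : ∀ i : ℤ ⊕ ℤ, Measurable (Sum.elim X Y i) := by
    rintro (i | i)
    · exact hXmeas i
    · exact hYmeas i
  have hEX : ∀ i, ∫ ω, X i ω ∂μ = pX := fun i =>
    sd_integral_01 μ pX hpX.1 (X i) (hXmeas i) (hX01 i) (hXp i)
  have hEY : ∀ i, ∫ ω, Y i ω ∂μ = pY := fun i =>
    sd_integral_01 μ pY hpY.1 (Y i) (hYmeas i) (hY01 i) (hYp i)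
  have hXX : ∀ i ω, X i ω * X i ω = X i ω := by
    intro i ω; rcases hX01 i ω with h | h <;> simp [h]
  have hYY : ∀ i ω, Y i ω * Y i ω = Y i ω := by
    intro i ω; rcases hY01 i ω with h | h <;> simp [h]
  have hE2 : ∀ a b, ∫ ω, X a ω * Y b ω ∂μ = pX * pY := by
    intro a b
    have := sd_integral_prod μ _ hZm hindep {Sum.inl a, Sum.inr b}
    simpa [Finset.prod_insert, hEX, hEY] using this
  have hE4 : ∀ a b c d, ∫ ω, (X a ω * Y b ω) * (X c ω * Y d ω) ∂μ
      = (if a = c then pX else pX ^ 2) * (if b = d then pY else pY ^ 2) := by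
    intro a b c d
    have key : ∀ ω, (X a ω * Y b ω) * (X c ω * Y d ω)
        = ∏ i ∈ ({a, c} : Finset ℤ).disjSum ({b, d} : Finset ℤ), Sum.elim X Y i ω := by
      intro ω
      rw [Finset.prod_disjSum]
      simp only [Sum.elim_inl, Sum.elim_inr]
      have h1 : ∏ x ∈ ({a, c} : Finset ℤ), X x ω = X a ω * X c ω := by
        by_cases h : a = c
        · subst h; simp [hXX]
        · rw [Finset.prod_pair h]
      have h2 : ∏ x ∈ ({b, d} : Finset ℤ), Y x ω = Y b ω * Y d ω := by
        by_cases h : b = d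
        · subst h; simp [hYY]
        · rw [Finset.prod_pair h]
      rw [h1, h2]; ring
    simp_rw [key]
    rw [sd_integral_prod μ _ hZm hindep, Finset.prod_disjSum]
    simp only [Sum.elim_inl, Sum.elim_inr, hEX, hEY, Finset.prod_const]
    congr 1
    · by_cases h : a = c
      · subst h; simp
      · rw [if_neg h, Finset.card_pair h]
    · by_cases h : b = d
      · subst h; simp
      · rw [if_neg h, Finset.card_pair h]
  have hbd : ∀ (f : Ω → ℝ), Measurable f → (∀ ω, f ω = 0 ∨ f ω = 1) → MemLp f ⊤ μ := by
    intro f hf h01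
    refine memLp_top_of_bound hf.aestronglyMeasurable 1 (Filter.Eventually.of_forall fun ω => ?_)
    rcases h01 ω with h | h <;> simp [h]
  have hXY01 : ∀ a b ω, X a ω * Y b ω = 0 ∨ X a ω * Y b ω = 1 := by
    intro a b ω
    rcases hX01 a ω with h | h <;> rcases hY01 b ω with h' | h' <;> simp [h, h']
  have hXYm : ∀ a b, Measurable (fun ω => X a ω * Y b ω) := fun a b => (hXmeas a).mul (hYmeas b)
  have hI2 : ∀ a b, Integrable (fun ω => X a ω * Y b ω) μ := fun a b =>
    (hbd _ (hXYm a b) (hXY01 a b)).integrable le_top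
  have hI4 : ∀ a b c d, Integrable (fun ω => (X a ω * Y b ω) * (X c ω * Y d ω)) μ := by
    intro a b c d
    refine (hbd _ ((hXYm a b).mul (hXYm c d)) fun ω => ?_).integrable le_top
    rcases hXY01 a b ω with h | h <;> rcases hXY01 c d ω with h' | h' <;> simp [h, h']
  have hW' : ∀ i, W i = fun ω => ∑ j ∈ Finset.Icc (-(δ : ℤ)) (δ : ℤ), X i ω * Y (i + j) ω := by
    intro i; funext ω; rw [hW, Finset.mul_sum]
  have hEW : ∀ i, ∫ ω, W i ω ∂μ = (2 * (δ : ℝ) + 1) * (pX * pY) := by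
    intro i
    rw [hW', integral_finset_sum _ (fun j _ => hI2 _ _)]
    simp only [hE2, Finset.sum_const, nsmul_eq_mul, Int.card_Icc]
    have : ((δ : ℤ) + 1 - -(δ : ℤ)).toNat = 2 * δ + 1 := by omega
    rw [this]; push_cast; ring
  have hEWW : ∀ k : ℤ, 0 ≤ k → k ≤ 2 * (δ : ℤ) + 1 → ∫ ω, W ℓ ω * W (ℓ + k) ω ∂μ
      = (if ℓ = ℓ + k then pX else pX ^ 2)
        * ((2 * (δ : ℝ) + 1) ^ 2 * pY ^ 2 + (2 * (δ : ℝ) + 1 - k) * (pY - pY ^ 2)) := by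
    intro k h0 h1
    rw [hW', hW']
    simp only [Finset.sum_mul_sum]
    rw [integral_finset_sum _ (fun i _ => integrable_finset_sum _ (fun j _ => hI4 _ _ _ _))]
    rw [← sd_count δ k h0 h1 ℓ, Finset.mul_sum]
    refine Finset.sum_congr rfl fun i _ => ?_
    rw [integral_finset_sum _ (fun j _ => hI4 _ _ _ _), Finset.mul_sum]
    exact Finset.sum_congr rfl fun j _ => hE4 _ _ _ _
  have hWL : MemLp (W ℓ) 2 μ := by
    rw [hW']
    exact memLp_finset_sum _ fun j _ => (hbd _ (hXYm _ _) (hXY01 _ _)).mono_exponent le_top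
  have hvar : variance (W ℓ) μ = pX * ((2 * (δ : ℝ) + 1) ^ 2 * pY ^ 2
      + (2 * (δ : ℝ) + 1) * (pY - pY ^ 2)) - ((2 * (δ : ℝ) + 1) * (pX * pY)) ^ 2 := by
    rw [variance_eq_sub hWL, hEW]
    have h := hEWW 0 le_rfl (by positivity)
    simp only [add_zero, if_true, Int.cast_zero, sub_zero] at h
    rw [← h]
    simp [pow_two]
  have hcov : ∀ k ∈ Finset.Icc (1 : ℤ) (2 * (δ : ℤ) + 1),
      ((∫ ω, W ℓ ω * W (ℓ + k) ω ∂μ) - (∫ ω, W ℓ ω ∂μ) * (∫ ω, W (ℓ + k) ω ∂μ))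
      = pX ^ 2 * (pY - pY ^ 2) * (((2 * δ + 1 : ℕ) : ℝ) - k) := by
    intro k hk
    rw [Finset.mem_Icc] at hk
    rw [hEW, hEW, hEWW k (by omega) hk.2, if_neg (by omega)]
    push_cast; ring
  rw [hvar, Finset.sum_congr rfl hcov, ← Finset.mul_sum]
  have hg := sd_gauss (2 * δ + 1)
  have hn : (((2 * δ + 1 : ℕ)) : ℤ) = 2 * (δ : ℤ) + 1 := by push_cast; ring
  rw [hn] at hg
  rw [hg]
  push_cast; ring
end

section
/- As T → ∞ with δ fixed, the normalized mark count (|S_{T,δ}| − E(|S_{T,δ}|))/√T converges in distribution to a centered Gaussian random variable with variance σ_δ², where σ_δ² = (2δ+1) p_X p_Y (1 − p_X p_Y) + 2δ(2δ+1) p_X p_Y (p_Y(1 − p_X) + p_X(1 − p_Y)). -/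
open MeasureTheory ProbabilityTheory Filter BoundedContinuousFunction

namespace BandCLT

/-- Grouping independent variables into blocks. -/
lemma iIndepFun_blocks {Ω : Type*} [MeasurableSpace Ω] {μ : Measure Ω} [IsProbabilityMeasure μ]
    {κ : Type*} (V : ℕ → κ → Ω → ℝ) (hV : ∀ k j, Measurable (V k j))
    (h : iIndepFun (fun (p : (_ : ℕ) × κ) ω => V p.1 p.2 ω) μ) :
    iIndepFun (fun k ω => (fun j => V k j ω)) μ := by
  have : ∀ i j, IsProbabilityMeasure (μ.map (V i j)) :=
    fun i j ↦ Measure.isProbabilityMeasure_map (hV i j).aemeasurable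
  have h2 : ∀ i, iIndepFun (V i) μ := fun i =>
    h.precomp (g := fun j => (⟨i, j⟩ : (_ : ℕ) × κ)) (fun a b hab => by simpa using hab)
  have e : (MeasurableEquiv.piCurry (fun (_ : ℕ) (_ : κ) => ℝ)) ∘ (fun ω p ↦ V p.1 p.2 ω)
      = fun ω i j ↦ V i j ω := by
    ext; simp [Sigma.curry]
  rw [iIndepFun_iff_map_fun_eq_infinitePi_map (by fun_prop), ← e,
    ← Measure.map_map (by fun_prop) (by fun_prop),
    (iIndepFun_iff_map_fun_eq_infinitePi_map (by fun_prop)).1 h,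
    Measure.infinitePi_map_piCurry (fun i j ↦ μ.map (V i j))]
  congrm Measure.infinitePi fun i ↦ ?_
  rw [(iIndepFun_iff_map_fun_eq_infinitePi_map (by fun_prop)).1 (h2 i)]

lemma charFun_sub_le {Ω : Type*} [MeasurableSpace Ω] {μ : Measure Ω} [IsProbabilityMeasure μ]
    {A B : Ω → ℝ} (hA : Measurable A) (hB : Measurable B)
    (hL : MemLp (fun ω => A ω - B ω) 2 μ) (t : ℝ) :
    ‖charFun (μ.map A) t - charFun (μ.map B) t‖
      ≤ |t| * √(∫ ω, (A ω - B ω) ^ 2 ∂μ) := by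
  have key : ∀ x y : ℝ, ‖Complex.exp (t * x * Complex.I) - Complex.exp (t * y * Complex.I)‖
      ≤ |t| * |x - y| := by
    intro x y
    have h1 : Complex.exp (t * x * Complex.I) - Complex.exp (t * y * Complex.I)
        = Complex.exp ((t * y : ℝ) * Complex.I)
          * (Complex.exp (Complex.I * (t * (x - y) : ℝ)) - 1) := by
      rw [mul_sub, mul_one, ← Complex.exp_add]
      push_cast
      congr 2 <;> ring_nf
    rw [h1, norm_mul, Complex.norm_exp_ofReal_mul_I, one_mul]
    refine (Real.norm_exp_I_mul_ofReal_sub_one_le).trans ?_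
    rw [Real.norm_eq_abs, abs_mul]
  have hint : ∀ {C : Ω → ℝ}, Measurable C →
      Integrable (fun ω => Complex.exp (t * C ω * Complex.I)) μ := by
    intro C hC
    refine Integrable.of_bound (by fun_prop) 1 (Eventually.of_forall fun ω => ?_)
    have := Complex.norm_exp_ofReal_mul_I (t * C ω)
    push_cast at this
    exact this.le
  have hD : Integrable (fun ω => A ω - B ω) μ := hL.integrable (by norm_num)
  rw [charFun_apply_real, charFun_apply_real, integral_map hA.aemeasurable (by fun_prop),
    integral_map hB.aemeasurable (by fun_prop), ← integral_sub (hint hA) (hint hB)]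
  calc _ ≤ ∫ ω, ‖Complex.exp (t * A ω * Complex.I) - Complex.exp (t * B ω * Complex.I)‖ ∂μ :=
        norm_integral_le_integral_norm _
    _ ≤ ∫ ω, |t| * |A ω - B ω| ∂μ := by
        refine integral_mono ((hint hA).sub (hint hB)).norm (hD.abs.const_mul _) fun ω => key _ _
    _ = |t| * ∫ ω, |A ω - B ω| ∂μ := integral_const_mul _ _
    _ ≤ _ := by
        gcongr
        refine Real.le_sqrt_of_sq_le ?_
        have hL' : MemLp (fun ω => |A ω - B ω|) 2 μ := hL.abs
        have := variance_nonneg (fun ω => |A ω - B ω|) μ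
        rw [variance_eq_sub hL'] at this
        simp only [Pi.pow_apply, sq_abs] at this
        linarith

/-- Abstract approximation lemma. -/
lemma approx {Ω : Type*} [MeasurableSpace Ω] {μ : Measure Ω} [IsProbabilityMeasure μ]
    (D : ℕ → Ω → ℝ) (hD : ∀ T, Measurable (D T))
    (A : ℕ → ℕ → Ω → ℝ) (hA : ∀ m T, Measurable (A m T))
    (v : ℕ → NNReal) (v0 : NNReal) (hv : Tendsto v atTop (nhds v0))
    (hAlim : ∀ m, 0 < m → ∀ t, Tendsto (fun T => charFun (μ.map (A m T)) t) atTop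
      (nhds (charFun (gaussianReal 0 (v m)) t)))
    (hL : ∀ m T, MemLp (fun ω => D T ω - A m T ω) 2 μ)
    (C : ℝ) (hC : 0 ≤ C)
    (hdiff : ∀ m, 0 < m → ∀ T, 0 < T →
      ∫ ω, (D T ω - A m T ω) ^ 2 ∂μ ≤ C * ((m : ℝ) / T + 1 / m)) (t : ℝ) :
    Tendsto (fun T => charFun (μ.map (D T)) t) atTop (nhds (charFun (gaussianReal 0 v0) t)) := by
  rw [Metric.tendsto_atTop]
  intro ε hε
  have hvg : Tendsto (fun m => charFun (gaussianReal 0 (v m)) t) atTop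
      (nhds (charFun (gaussianReal 0 v0) t)) := by
    simp only [charFun_gaussianReal]
    have : Tendsto (fun m => ((v m : ℝ) : ℂ)) atTop (nhds ((v0 : ℝ) : ℂ)) :=
      ((Complex.continuous_ofReal.comp NNReal.continuous_coe).tendsto v0).comp hv
    refine (Complex.continuous_exp.tendsto _).comp ?_
    refine tendsto_const_nhds.sub ((this.mul_const _).div_const _)
  have h1 : Tendsto (fun m : ℕ => |t| * √(C * (1 / (m : ℝ) + 1 / m))) atTop (nhds 0) := by
    have : Tendsto (fun m : ℕ => 1 / (m : ℝ)) atTop (nhds 0) := tendsto_one_div_atTop_nhds_zero_nat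
    have := (((this.add this).const_mul C).sqrt).const_mul |t|
    simpa using this
  obtain ⟨m, hm0, hm1, hm2⟩ := ((eventually_gt_atTop 0).and
    ((h1.eventually (gt_mem_nhds (show (0:ℝ) < ε / 3 by positivity))).and
      (Metric.tendsto_nhds.1 hvg (ε / 3) (by positivity)))).exists
  obtain ⟨N, hN⟩ := Metric.tendsto_atTop.1 (hAlim m hm0 t) (ε / 3) (by positivity)
  refine ⟨max N (max (m * m) 1), fun T hT => ?_⟩
  have hT1 : N ≤ T := (le_max_left _ _).trans hT
  have hT2 : m * m ≤ T := (le_max_left _ _).trans ((le_max_right _ _).trans hT)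
  have hT3 : 0 < T := (le_max_right _ _).trans ((le_max_right _ _).trans hT)
  have hmT : (m : ℝ) / T ≤ 1 / m := by
    rw [div_le_div_iff₀ (by exact_mod_cast hT3) (by exact_mod_cast hm0), one_mul]
    exact_mod_cast hT2
  have e1 : dist (charFun (μ.map (D T)) t) (charFun (μ.map (A m T)) t) < ε / 3 := by
    rw [dist_eq_norm]
    refine (charFun_sub_le (hD T) (hA m T) (hL m T) t).trans_lt (lt_of_le_of_lt ?_ hm1)
    gcongr
    refine (hdiff m hm0 T hT3).trans ?_
    gcongr
  have e2 := hN T hT1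
  calc _ ≤ dist (charFun (μ.map (D T)) t) (charFun (μ.map (A m T)) t) +
        dist (charFun (μ.map (A m T)) t) (charFun (gaussianReal 0 (v m)) t) +
        dist (charFun (gaussianReal 0 (v m)) t) (charFun (gaussianReal 0 v0) t) :=
        dist_triangle4 _ _ _ _
    _ < ε / 3 + ε / 3 + ε / 3 := by linarith
    _ = ε := by ring

/-- CLT along `T ↦ T / m` with normalisation `√T`. -/
lemma clt_blocks {Ω : Type*} [MeasurableSpace Ω] {μ : Measure Ω} [IsProbabilityMeasure μ]
    (B : ℕ → Ω → ℝ) (hB2 : MemLp (B 0) 2 μ)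
    (hi : iIndepFun B μ) (hid : ∀ i, IdentDistrib (B i) (B 0) μ μ) (m : ℕ) (hm : 0 < m) (t : ℝ) :
    Tendsto (fun T : ℕ => charFun (μ.map (fun ω =>
      (∑ k ∈ Finset.range (T / m), B k ω - (T / m : ℕ) * ∫ ω', B 0 ω' ∂μ) / √T)) t) atTop
      (nhds (charFun (gaussianReal 0 (Var[B 0; μ] / m).toNNReal) t)) := by
  have hlaw : HasLaw (id : ℝ → ℝ) (gaussianReal 0 Var[B 0; μ].toNNReal)
    (gaussianReal 0 Var[B 0; μ].toNNReal) := HasLaw.id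
  have h0 := tendstoInDistribution_inv_sqrt_mul_sum_sub hlaw hB2 hi hid
  have hdiv : Tendsto (fun T : ℕ => T / m) atTop atTop :=
    Nat.tendsto_div_const_atTop hm.ne'
  have h1 : TendstoInDistribution (fun (T : ℕ) ω ↦ (√((T / m : ℕ) : ℝ))⁻¹ *
      (∑ k ∈ Finset.range (T / m), B k ω - (T / m : ℕ) * μ[B 0])) atTop (id : ℝ → ℝ)
      (fun _ ↦ μ) (gaussianReal 0 Var[B 0; μ].toNNReal) :=
    ⟨fun T => h0.forall_aemeasurable (T / m), h0.aemeasurable_limit, h0.tendsto.comp hdiv⟩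
  have hc : Tendsto (fun T : ℕ => √((T / m : ℕ) : ℝ) / √T) atTop (nhds (√(1 / m))) := by
    have : Tendsto (fun T : ℕ => ((T / m : ℕ) : ℝ) / T) atTop (nhds (1 / m)) := by
      have hm' : (0 : ℝ) < m := by exact_mod_cast hm
      have := (tendsto_nat_floor_div_atTop (R := ℝ)).comp
        ((tendsto_natCast_atTop_atTop (R := ℝ)).atTop_div_const hm')
      have := this.mul_const (1 / (m : ℝ))
      rw [one_mul] at this
      refine this.congr fun T => ?_
      simp only [Function.comp]
      rw [Nat.floor_div_natCast, Nat.floor_natCast]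
      field_simp
    refine this.sqrt.congr fun T => ?_
    rw [Real.sqrt_div (by positivity)]
  have h2 := h1.continuous_comp_prodMk_of_tendstoInMeasure_const
    (g := fun p : ℝ × ℝ => p.1 * p.2) (by fun_prop)
    (Y := fun T _ => √((T / m : ℕ) : ℝ) / √T) (c := √(1 / m))
    (tendstoInMeasure_of_tendsto_ae (fun _ => by fun_prop) (Eventually.of_forall fun _ => hc))
    (fun _ => by fun_prop)
  have h3 := ProbabilityMeasure.tendsto_iff_tendsto_charFun.1 h2.tendsto t
  have e : (gaussianReal 0 Var[B 0; μ].toNNReal).map (fun ω => id ω * √(1 / (m : ℝ)))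
      = gaussianReal 0 (Var[B 0; μ] / m).toNNReal := by
    simp only [id]
    rw [gaussianReal_map_mul_const]
    congr 1
    · simp
    · ext
      have := variance_nonneg (B 0) μ
      have hs : √(1 / (m : ℝ)) ^ 2 = 1 / m := Real.sq_sqrt (by positivity)
      rw [NNReal.coe_mul, NNReal.coe_mk, hs, Real.coe_toNNReal _ this,
        Real.coe_toNNReal _ (by positivity)]
      ring
  simp only [ProbabilityMeasure.coe_mk, e] at h3
  refine h3.congr fun T => ?_
  congr 2
  ext ω
  by_cases hn : T / m = 0
  · simp [hn]
  · have : √((T / m : ℕ) : ℝ) ≠ 0 := by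
      rw [Real.sqrt_ne_zero']; exact_mod_cast Nat.pos_of_ne_zero hn
    field_simp

end BandCLT

namespace BandCLT

/-- The band of width `δ` in `[1,m]²`. -/
def Q (δ m : ℕ) : Finset (ℕ × ℕ) :=
  ((Finset.Icc 1 m) ×ˢ (Finset.Icc 1 m)).filter
    (fun p : ℕ × ℕ => ((p.1 : ℤ) - (p.2 : ℤ)).natAbs ≤ δ)

/-- Number of column indices in the band at row `i`. -/
def dg (δ m i : ℕ) : ℕ :=
  ((Finset.Icc 1 m).filter (fun j : ℕ => ((i : ℤ) - (j : ℤ)).natAbs ≤ δ)).card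

lemma dg_le (δ m i : ℕ) : dg δ m i ≤ 2 * δ + 1 := by
  unfold dg
  calc _ ≤ (Finset.Icc (i - δ) (i + δ)).card := by
        apply Finset.card_le_card
        intro j hj
        simp only [Finset.mem_filter, Finset.mem_Icc] at hj ⊢
        omega
    _ ≤ _ := by rw [Nat.card_Icc]; omega

lemma dg_eq (δ m i : ℕ) (h1 : δ < i) (h2 : i + δ ≤ m) : dg δ m i = 2 * δ + 1 := by
  unfold dg
  have : (Finset.Icc 1 m).filter (fun j : ℕ => ((i : ℤ) - (j : ℤ)).natAbs ≤ δ)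
      = Finset.Icc (i - δ) (i + δ) := by
    ext j
    simp only [Finset.mem_filter, Finset.mem_Icc]
    omega
  rw [this, Nat.card_Icc]; omega

lemma sum_dg_le (δ m : ℕ) (g : ℕ → ℕ) (hg : Monotone g) :
    ∑ i ∈ Finset.Icc 1 m, g (dg δ m i) ≤ m * g (2 * δ + 1) := by
  calc _ ≤ ∑ i ∈ Finset.Icc 1 m, g (2 * δ + 1) :=
        Finset.sum_le_sum fun i _ => hg (dg_le δ m i)
    _ = _ := by simp

lemma le_sum_dg (δ m : ℕ) (g : ℕ → ℕ) :
    (m - 2 * δ) * g (2 * δ + 1) ≤ ∑ i ∈ Finset.Icc 1 m, g (dg δ m i) := by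
  calc _ = ∑ i ∈ Finset.Icc (δ + 1) (m - δ), g (dg δ m i) := by
        rw [Finset.sum_congr rfl (g := fun _ => g (2 * δ + 1))]
        · simp only [Finset.sum_const, Nat.card_Icc, smul_eq_mul]
          congr 1; omega
        · intro i hi
          simp only [Finset.mem_Icc] at hi
          rw [dg_eq δ m i (by omega) (by omega)]
    _ ≤ _ := by
        apply Finset.sum_le_sum_of_subset
        intro i hi
        simp only [Finset.mem_Icc] at hi ⊢
        omega

lemma tendsto_sum_dg (δ : ℕ) (g : ℕ → ℕ) (hg : Monotone g) :
    Tendsto (fun m : ℕ => ((∑ i ∈ Finset.Icc 1 m, g (dg δ m i) : ℕ) : ℝ) / m) atTop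
      (nhds (g (2 * δ + 1) : ℝ)) := by
  have h0 : Tendsto (fun m : ℕ => 1 / (m : ℝ)) atTop (nhds 0) := tendsto_one_div_atTop_nhds_zero_nat
  have hl : Tendsto (fun m : ℕ => (g (2 * δ + 1) : ℝ) - (2 * δ * g (2 * δ + 1)) * (1 / (m : ℝ)))
      atTop (nhds (g (2 * δ + 1) : ℝ)) := by
    simpa using tendsto_const_nhds.sub (h0.const_mul (2 * (δ : ℝ) * g (2 * δ + 1)))
  refine tendsto_of_tendsto_of_tendsto_of_le_of_le' hl tendsto_const_nhds ?_ ?_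
  · filter_upwards [eventually_gt_atTop (2 * δ)] with m hm
    have hm0 : (0 : ℝ) < m := by exact_mod_cast (by omega : 0 < m)
    have := le_sum_dg δ m g
    have h2 : ((m : ℝ) - 2 * δ) * g (2 * δ + 1) ≤ ((∑ i ∈ Finset.Icc 1 m, g (dg δ m i) : ℕ) : ℝ) := by
      have h3 : ((m - 2 * δ : ℕ) : ℝ) = (m : ℝ) - 2 * δ := by
        rw [Nat.cast_sub hm.le]; push_cast; ring
      rw [← h3]; exact_mod_cast this
    rw [le_div_iff₀ hm0]
    refine le_trans (le_of_eq ?_) h2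
    field_simp
  · filter_upwards [eventually_gt_atTop 0] with m hm
    have hm0 : (0 : ℝ) < m := by exact_mod_cast hm
    rw [div_le_iff₀ hm0, mul_comm]
    exact_mod_cast sum_dg_le δ m g hg

lemma card_Q (δ m : ℕ) : (Q δ m).card = ∑ i ∈ Finset.Icc 1 m, dg δ m i := by
  unfold Q dg
  rw [Finset.card_filter, Finset.sum_product]
  simp only [Finset.card_filter]

lemma sum_Q_row (δ m : ℕ) (f : ℕ × ℕ → ℝ) :
    ∑ p ∈ Q δ m, f p = ∑ i ∈ Finset.Icc 1 m,
      ∑ j ∈ (Finset.Icc 1 m).filter (fun j : ℕ => ((i : ℤ) - (j : ℤ)).natAbs ≤ δ), f (i, j) := by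
  unfold Q
  rw [Finset.sum_filter, Finset.sum_product]
  simp only [Finset.sum_filter]

lemma sum_fst (δ m : ℕ) : ∑ p ∈ Q δ m, ∑ q ∈ Q δ m, (if p.1 = q.1 then (1 : ℝ) else 0)
    = ((∑ i ∈ Finset.Icc 1 m, (dg δ m i) ^ 2 : ℕ) : ℝ) := by
  rw [sum_Q_row]
  push_cast
  refine Finset.sum_congr rfl fun i hi => ?_
  have : ∑ q ∈ Q δ m, (if i = q.1 then (1 : ℝ) else 0) = dg δ m i := by
    rw [sum_Q_row]
    simp only [Finset.sum_const, nsmul_eq_mul]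
    rw [Finset.sum_eq_single i]
    · simp [dg]
    · intro b _ hb; simp [Ne.symm hb]
    · intro h; exact absurd hi h
  simp only [this, Finset.sum_const, nsmul_eq_mul]
  rw [sq]; rfl

lemma swap_Q (δ m : ℕ) (f : ℕ × ℕ → ℝ) : ∑ p ∈ Q δ m, f p = ∑ p ∈ Q δ m, f p.swap := by
  refine Finset.sum_nbij' Prod.swap Prod.swap ?_ ?_ ?_ ?_ ?_
  · intro p hp; simp only [Q, Finset.mem_filter, Finset.mem_product, Prod.fst_swap, Prod.snd_swap] at hp ⊢
    refine ⟨hp.1.symm, by omega⟩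
  · intro p hp; simp only [Q, Finset.mem_filter, Finset.mem_product, Prod.fst_swap, Prod.snd_swap] at hp ⊢
    refine ⟨hp.1.symm, by omega⟩
  · simp
  · simp
  · simp

lemma sum_snd (δ m : ℕ) : ∑ p ∈ Q δ m, ∑ q ∈ Q δ m, (if p.2 = q.2 then (1 : ℝ) else 0)
    = ((∑ i ∈ Finset.Icc 1 m, (dg δ m i) ^ 2 : ℕ) : ℝ) := by
  rw [← sum_fst, swap_Q]
  refine Finset.sum_congr rfl fun p _ => ?_
  rw [swap_Q]
  rfl

lemma count_fst (δ T : ℕ) (P : Finset (ℕ × ℕ)) (hP : P ⊆ Q δ T) (p : ℕ × ℕ) :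
    ∑ q ∈ P, (if p.1 = q.1 then (1 : ℝ) else 0) ≤ 2 * δ + 1 := by
  calc _ ≤ ∑ q ∈ Q δ T, (if p.1 = q.1 then (1 : ℝ) else 0) := by
        apply Finset.sum_le_sum_of_subset_of_nonneg hP
        intros; split_ifs <;> norm_num
    _ ≤ (dg δ T p.1 : ℝ) := by
        rw [sum_Q_row]
        simp only [Finset.sum_const, nsmul_eq_mul]
        by_cases h : p.1 ∈ Finset.Icc 1 T
        · rw [Finset.sum_eq_single p.1]
          · simp [dg]
          · intro b _ hb; simp [Ne.symm hb]
          · intro h'; exact absurd h h'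
        · rw [Finset.sum_eq_zero]
          · positivity
          · intro b hb
            have : p.1 ≠ b := by rintro rfl; exact h hb
            simp [this]
    _ ≤ _ := by exact_mod_cast dg_le δ T p.1

lemma count_snd (δ T : ℕ) (P : Finset (ℕ × ℕ)) (hP : P ⊆ Q δ T) (p : ℕ × ℕ) :
    ∑ q ∈ P, (if p.2 = q.2 then (1 : ℝ) else 0) ≤ 2 * δ + 1 := by
  calc _ ≤ ∑ q ∈ Q δ T, (if p.2 = q.2 then (1 : ℝ) else 0) := by
        apply Finset.sum_le_sum_of_subset_of_nonneg hP
        intros; split_ifs <;> norm_num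
    _ = ∑ q ∈ Q δ T, (if p.swap.1 = q.1 then (1 : ℝ) else 0) := by
        rw [swap_Q]; rfl
    _ ≤ _ := count_fst δ T _ subset_rfl _

/-- Image of the blocks. -/
def G (δ m n : ℕ) : Finset (ℕ × ℕ) :=
  (Finset.range n ×ˢ Q δ m).image (fun r => (r.1 * m + r.2.1, r.1 * m + r.2.2))

lemma blk_inj {m k k' a a' : ℕ} (ha : 1 ≤ a) (ha2 : a ≤ m) (ha' : 1 ≤ a') (ha2' : a' ≤ m)
    (h : k * m + a = k' * m + a') : k = k' ∧ a = a' := by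
  have : k = k' := by
    rcases lt_trichotomy k k' with h1 | h1 | h1
    · have : (k + 1) * m ≤ k' * m := Nat.mul_le_mul_right _ h1
      rw [add_mul] at this; omega
    · exact h1
    · have : (k' + 1) * m ≤ k * m := Nat.mul_le_mul_right _ h1
      rw [add_mul] at this; omega
  subst this
  exact ⟨rfl, by omega⟩

lemma G_inj (δ m n : ℕ) : Set.InjOn (fun r : ℕ × ℕ × ℕ => (r.1 * m + r.2.1, r.1 * m + r.2.2))
    (Finset.range n ×ˢ Q δ m : Finset (ℕ × ℕ × ℕ)) := by
  rintro ⟨k, a, b⟩ h ⟨k', a', b'⟩ h' e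
  simp only [Q, Finset.coe_product, Set.mem_prod, Finset.mem_coe, Finset.mem_filter,
    Finset.mem_product, Finset.mem_Icc, Prod.mk.injEq] at h h' e
  obtain ⟨h1, h2⟩ := blk_inj h.2.1.1.1 h.2.1.1.2 h'.2.1.1.1 h'.2.1.1.2 e.1
  subst h1
  simp only [Prod.mk.injEq, true_and]
  exact ⟨h2, by omega⟩

lemma G_sub (δ m T : ℕ) : G δ m (T / m) ⊆ Q δ T := by
  intro p hp
  simp only [G, Finset.mem_image, Finset.mem_product, Finset.mem_range] at hp
  obtain ⟨⟨k, a, b⟩, ⟨hk, hq⟩, rfl⟩ := hp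
  simp only [Q, Finset.mem_filter, Finset.mem_product, Finset.mem_Icc] at hq ⊢
  have h1 : (k + 1) * m ≤ T := (Nat.mul_le_mul_right _ hk).trans (Nat.div_mul_le_self T m)
  rw [add_mul] at h1
  refine ⟨⟨⟨?_, ?_⟩, ?_, ?_⟩, ?_⟩ <;> push_cast <;> omega

lemma card_bad (δ m T : ℕ) (hm : 0 < m) :
    (((Q δ T) \ (G δ m (T / m))).card : ℝ) ≤ (2 * δ + 1) ^ 2 * (m + T / m) := by
  have h1 : ((Q δ T) \ (G δ m (T / m))).card + (T / m) * (Q δ m).card = (Q δ T).card := by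
    have : (G δ m (T / m)).card = (T / m) * (Q δ m).card := by
      rw [G, Finset.card_image_of_injOn (G_inj δ m _), Finset.card_product, Finset.card_range]
    rw [← this, Finset.card_sdiff_add_card_eq_card (G_sub δ m T)]
  have h2 := sum_dg_le δ T id monotone_id
  have h3 := le_sum_dg δ m id
  simp only [id] at h2 h3
  rw [← card_Q] at h2 h3
  have h3' : ((m : ℝ) - 2 * δ) * (2 * δ + 1) ≤ (Q δ m).card := by
    refine le_trans ?_ (Nat.cast_le.2 h3)
    push_cast
    gcongr
    have : m ≤ (m - 2 * δ) + 2 * δ := by omega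
    have : (m : ℝ) ≤ ((m - 2 * δ : ℕ) : ℝ) + 2 * δ := by exact_mod_cast this
    linarith
  have h2' : ((Q δ T).card : ℝ) ≤ T * (2 * δ + 1) := by exact_mod_cast h2
  have h1' : (((Q δ T) \ (G δ m (T / m))).card : ℝ) + (T / m : ℕ) * (Q δ m).card
    = (Q δ T).card := by exact_mod_cast h1
  have hm0 : (0 : ℝ) < m := by exact_mod_cast hm
  have hn : (T : ℝ) ≤ (T / m : ℕ) * m + m := by
    have := Nat.lt_div_mul_add hm (a := T)
    exact_mod_cast this.le
  have hn2 : ((T / m : ℕ) : ℝ) ≤ T / m := Nat.cast_div_le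
  have hn0 : (0 : ℝ) ≤ (T / m : ℕ) := by positivity
  have hd : (0 : ℝ) ≤ δ := by positivity
  calc _ ≤ (T : ℝ) * (2 * δ + 1) - (T / m : ℕ) * (((m : ℝ) - 2 * δ) * (2 * δ + 1)) := by
        have := mul_le_mul_of_nonneg_left h3' hn0
        linarith
    _ = (2 * δ + 1) * (T - (T / m : ℕ) * m + (T / m : ℕ) * (2 * δ)) := by ring
    _ ≤ (2 * δ + 1) * (m + (T / m) * (2 * δ)) := by gcongr; linarith
    _ ≤ (2 * δ + 1) * ((2 * δ + 1) * (m + T / m)) := by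
        gcongr
        have : (0 : ℝ) ≤ T / m := by positivity
        nlinarith
    _ = _ := by ring

end BandCLT

namespace BandCLT

/-- The standing hypotheses. -/
structure Hyp {Ω : Type*} [MeasurableSpace Ω] (μ : Measure Ω) (pX pY : ℝ)
    (X Y : ℕ → Ω → ℝ) : Prop where
  hpX : pX ∈ Set.Icc (0 : ℝ) 1
  hpY : pY ∈ Set.Icc (0 : ℝ) 1
  mX : ∀ i, Measurable (X i)
  mY : ∀ i, Measurable (Y i)
  hX01 : ∀ i ω, X i ω = 0 ∨ X i ω = 1
  hY01 : ∀ j ω, Y j ω = 0 ∨ Y j ω = 1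
  hindep : iIndepFun (m := fun _ : ℕ ⊕ ℕ => Real.measurableSpace) (Sum.elim X Y) μ
  hXp : ∀ i, μ {ω | X i ω = 1} = ENNReal.ofReal pX
  hYp : ∀ j, μ {ω | Y j ω = 1} = ENNReal.ofReal pY

/-- The sum over pairs. -/
def W {Ω : Type*} (X Y : ℕ → Ω → ℝ) (P : Finset (ℕ × ℕ)) (ω : Ω) : ℝ :=
  ∑ p ∈ P, X p.1 ω * Y p.2 ω

lemma identDistrib_01 {Ω : Type*} [MeasurableSpace Ω] {μ : Measure Ω} [IsProbabilityMeasure μ]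
    {U V : Ω → ℝ} (hU : Measurable U) (hV : Measurable V) (hU01 : ∀ ω, U ω = 0 ∨ U ω = 1)
    (hV01 : ∀ ω, V ω = 0 ∨ V ω = 1) (h : μ {ω | U ω = 1} = μ {ω | V ω = 1}) :
    IdentDistrib U V μ μ := by
  refine ⟨hU.aemeasurable, hV.aemeasurable, ?_⟩
  have key : ∀ {Z : Ω → ℝ}, Measurable Z → (∀ ω, Z ω = 0 ∨ Z ω = 1) →
      μ {ω | Z ω = 0} = 1 - μ {ω | Z ω = 1} := by
    intro Z hZ h01
    have hs : {ω | Z ω = 0} = {ω | Z ω = 1}ᶜ := by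
      ext ω
      simp only [Set.mem_setOf_eq, Set.mem_compl_iff]
      rcases h01 ω with h | h <;> simp [h]
    have hms : MeasurableSet {ω | Z ω = 1} := hZ (measurableSet_singleton 1)
    rw [hs]
    exact prob_compl_eq_one_sub hms
  rw [(Measure.ae_eq_or_eq_iff_map_eq_dirac_add_dirac hU.aemeasurable zero_ne_one).1
      (Eventually.of_forall hU01),
    (Measure.ae_eq_or_eq_iff_map_eq_dirac_add_dirac hV.aemeasurable zero_ne_one).1
      (Eventually.of_forall hV01)]
  have e1 : μ (U ⁻¹' {0}) = μ (V ⁻¹' {0}) := by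
    have := key hU hU01
    have h2 := key hV hV01
    rw [h, ← h2] at this
    exact this
  have e2 : μ (U ⁻¹' {1}) = μ (V ⁻¹' {1}) := h
  rw [e1, e2]

namespace Hyp

variable {Ω : Type*} [MeasurableSpace Ω] {μ : Measure Ω} [IsProbabilityMeasure μ]
  {pX pY : ℝ} {X Y : ℕ → Ω → ℝ}

lemma EX (H : Hyp μ pX pY X Y) (i : ℕ) : ∫ ω, X i ω ∂μ = pX := by
  rw [integral_of_ae_eq_zero_or_one (H.mX i).aemeasurable (Eventually.of_forall (H.hX01 i)),
    Measure.real, H.hXp, ENNReal.toReal_ofReal H.hpX.1]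

lemma EY (H : Hyp μ pX pY X Y) (i : ℕ) : ∫ ω, Y i ω ∂μ = pY := by
  rw [integral_of_ae_eq_zero_or_one (H.mY i).aemeasurable (Eventually.of_forall (H.hY01 i)),
    Measure.real, H.hYp, ENNReal.toReal_ofReal H.hpY.1]

lemma mE (H : Hyp μ pX pY X Y) (s : ℕ ⊕ ℕ) : Measurable (Sum.elim X Y s) := by
  rcases s with s | s
  · exact H.mX s
  · exact H.mY s

lemma Eprod (H : Hyp μ pX pY X Y) (U : Finset (ℕ ⊕ ℕ)) :
    ∫ ω, ∏ s ∈ U, Sum.elim X Y s ω ∂μ = ∏ s ∈ U, Sum.elim (fun _ => pX) (fun _ => pY) s := by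
  have h := (H.hindep.restrict U).integral_fun_prod_eq_prod_integral
    (fun s => (H.mE s).aestronglyMeasurable)
  have h2 : ∀ s, ∫ ω, Sum.elim X Y s ω ∂μ = Sum.elim (fun _ => pX) (fun _ => pY) s := by
    rintro (s | s)
    · exact H.EX s
    · exact H.EY s
  simp only [Finset.restrict] at h
  rw [← Finset.prod_coe_sort U (fun s => Sum.elim (fun _ => pX) (fun _ => pY) s)]
  simp only [← h2]
  rw [← h]
  refine integral_congr_ae (Eventually.of_forall fun ω => ?_)
  exact (Finset.prod_coe_sort U (fun s => Sum.elim X Y s ω)).symm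

lemma sqX (H : Hyp μ pX pY X Y) (i : ℕ) (ω : Ω) : X i ω * X i ω = X i ω := by
  rcases H.hX01 i ω with h | h <;> simp [h]

lemma sqY (H : Hyp μ pX pY X Y) (i : ℕ) (ω : Ω) : Y i ω * Y i ω = Y i ω := by
  rcases H.hY01 i ω with h | h <;> simp [h]

lemma E2 (H : Hyp μ pX pY X Y) (i j : ℕ) : ∫ ω, X i ω * Y j ω ∂μ = pX * pY := by
  have := H.Eprod {Sum.inl i, Sum.inr j}
  simpa using this

lemma memLp (H : Hyp μ pX pY X Y) (p : ℕ × ℕ) :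
    MemLp (fun ω => X p.1 ω * Y p.2 ω) 2 μ := by
  refine MemLp.of_bound ((H.mX _).mul (H.mY _)).aestronglyMeasurable 1
    (Eventually.of_forall fun ω => ?_)
  rcases H.hX01 p.1 ω with h | h <;> rcases H.hY01 p.2 ω with h' | h' <;> simp [h, h']

lemma memLpW (H : Hyp μ pX pY X Y) (P : Finset (ℕ × ℕ)) : MemLp (W X Y P) 2 μ :=
  memLp_finset_sum P fun p _ => H.memLp p

lemma mW (H : Hyp μ pX pY X Y) (P : Finset (ℕ × ℕ)) : Measurable (W X Y P) :=
  Finset.measurable_fun_sum P fun p _ => (H.mX _).mul (H.mY _)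

lemma cov (H : Hyp μ pX pY X Y) (p q : ℕ × ℕ) :
    cov[fun ω => X p.1 ω * Y p.2 ω, fun ω => X q.1 ω * Y q.2 ω; μ]
      = pX * pY ^ 2 * (1 - pX) * (if p.1 = q.1 then 1 else 0)
        + pX ^ 2 * pY * (1 - pY) * (if p.2 = q.2 then 1 else 0)
        + pX * pY * (1 - pX) * (1 - pY) * (if p = q then 1 else 0) := by
  rw [covariance_eq_sub (H.memLp p) (H.memLp q), H.E2, H.E2]
  obtain ⟨i, j⟩ := p
  obtain ⟨k, l⟩ := q
  have e : ∫ ω, ((fun ω => X i ω * Y j ω) * fun ω => X k ω * Y l ω) ω ∂μ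
      = (if i = k then pX else pX ^ 2) * (if j = l then pY else pY ^ 2) := by
    simp only [Pi.mul_apply]
    by_cases h1 : i = k <;> by_cases h2 : j = l
    · subst h1 h2
      have := H.E2 i j
      simp only [if_true]
      rw [← this]
      congr 1; ext ω
      rw [mul_mul_mul_comm, H.sqX, H.sqY]
    · subst h1
      have := H.Eprod {Sum.inl i, Sum.inr j, Sum.inr l}
      rw [Finset.prod_insert (by simp), Finset.prod_insert (by simpa using h2)] at this
      simp only [Finset.prod_singleton, Sum.elim_inl, Sum.elim_inr] at this
      simp only [if_true, h2, if_false]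
      rw [sq, ← this]
      congr 1; ext ω
      rw [Finset.prod_insert (by simp), Finset.prod_insert (by simpa using h2)]
      simp only [Finset.prod_singleton, Sum.elim_inl, Sum.elim_inr]
      rw [mul_mul_mul_comm, H.sqX]
    · subst h2
      have := H.Eprod {Sum.inr j, Sum.inl i, Sum.inl k}
      rw [Finset.prod_insert (by simp), Finset.prod_insert (by simpa using h1)] at this
      simp only [Finset.prod_singleton, Sum.elim_inl, Sum.elim_inr] at this
      simp only [if_true, h1, if_false]
      rw [sq, mul_comm, ← this]
      congr 1; ext ω
      rw [Finset.prod_insert (by simp), Finset.prod_insert (by simpa using h1)]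
      simp only [Finset.prod_singleton, Sum.elim_inl, Sum.elim_inr]
      rw [mul_mul_mul_comm, H.sqY]; ring
    · have := H.Eprod {Sum.inl i, Sum.inl k, Sum.inr j, Sum.inr l}
      rw [Finset.prod_insert (by simpa using h1), Finset.prod_insert (by simp),
        Finset.prod_insert (by simpa using h2)] at this
      simp only [Finset.prod_singleton, Sum.elim_inl, Sum.elim_inr] at this
      simp only [h1, h2, if_false]
      rw [show pX ^ 2 * pY ^ 2 = pX * (pX * (pY * pY)) by ring, ← this]
      congr 1; ext ω
      rw [Finset.prod_insert (by simpa using h1), Finset.prod_insert (by simp),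
        Finset.prod_insert (by simpa using h2)]
      simp only [Finset.prod_singleton, Sum.elim_inl, Sum.elim_inr]
      ring
  rw [e]
  simp only [Prod.mk.injEq]
  by_cases h1 : i = k <;> by_cases h2 : j = l <;> simp [h1, h2] <;> ring

lemma varW (H : Hyp μ pX pY X Y) (P : Finset (ℕ × ℕ)) :
    Var[W X Y P; μ] = pX * pY ^ 2 * (1 - pX) * (∑ p ∈ P, ∑ q ∈ P, if p.1 = q.1 then 1 else 0)
        + pX ^ 2 * pY * (1 - pY) * (∑ p ∈ P, ∑ q ∈ P, if p.2 = q.2 then 1 else 0)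
        + pX * pY * (1 - pX) * (1 - pY) * P.card := by
  have h : W X Y P = ∑ p ∈ P, fun ω => X p.1 ω * Y p.2 ω := by
    ext ω; simp [W]
  rw [h, variance_sum' fun p _ => H.memLp p]
  simp only [H.cov, Finset.sum_add_distrib, ← Finset.mul_sum]
  congr 2
  simp

lemma varW_le (H : Hyp μ pX pY X Y) (δ T : ℕ) (P : Finset (ℕ × ℕ)) (hP : P ⊆ Q δ T) :
    Var[W X Y P; μ] ≤ 3 * (2 * δ + 1) * P.card := by
  rw [H.varW]
  obtain ⟨hx0, hx1⟩ := H.hpX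
  obtain ⟨hy0, hy1⟩ := H.hpY
  have h1 : ∑ p ∈ P, ∑ q ∈ P, (if p.1 = q.1 then (1 : ℝ) else 0) ≤ (2 * δ + 1) * P.card := by
    calc _ ≤ ∑ p ∈ P, (2 * (δ : ℝ) + 1) := Finset.sum_le_sum fun p _ => count_fst δ T P hP p
      _ = _ := by rw [Finset.sum_const, nsmul_eq_mul, mul_comm]
  have h2 : ∑ p ∈ P, ∑ q ∈ P, (if p.2 = q.2 then (1 : ℝ) else 0) ≤ (2 * δ + 1) * P.card := by
    calc _ ≤ ∑ p ∈ P, (2 * (δ : ℝ) + 1) := Finset.sum_le_sum fun p _ => count_snd δ T P hP p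
      _ = _ := by rw [Finset.sum_const, nsmul_eq_mul, mul_comm]
  have h3 : (P.card : ℝ) ≤ (2 * δ + 1) * P.card := by
    have : (0 : ℝ) ≤ δ * P.card := by positivity
    linarith
  have hx1' : 0 ≤ 1 - pX := by linarith
  have hy1' : 0 ≤ 1 - pY := by linarith
  have c1 : pX * pY ^ 2 * (1 - pX) ≤ 1 :=
    mul_le_one₀ (mul_le_one₀ hx1 (by positivity) (pow_le_one₀ hy0 hy1)) hx1' (by linarith)
  have c2 : pX ^ 2 * pY * (1 - pY) ≤ 1 :=
    mul_le_one₀ (mul_le_one₀ (pow_le_one₀ hx0 hx1) hy0 hy1) hy1' (by linarith)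
  have c3 : pX * pY * (1 - pX) * (1 - pY) ≤ 1 :=
    mul_le_one₀ (mul_le_one₀ (mul_le_one₀ hx1 hy0 hy1) hx1' (by linarith)) hy1' (by linarith)
  have n1 : (0 : ℝ) ≤ ∑ p ∈ P, ∑ q ∈ P, (if p.1 = q.1 then (1 : ℝ) else 0) :=
    Finset.sum_nonneg fun _ _ => Finset.sum_nonneg fun _ _ => by split_ifs <;> norm_num
  have n2 : (0 : ℝ) ≤ ∑ p ∈ P, ∑ q ∈ P, (if p.2 = q.2 then (1 : ℝ) else 0) :=
    Finset.sum_nonneg fun _ _ => Finset.sum_nonneg fun _ _ => by split_ifs <;> norm_num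
  have d1 := mul_le_of_le_one_left n1 c1
  have d2 := mul_le_of_le_one_left n2 c2
  have d3 := mul_le_of_le_one_left (Nat.cast_nonneg (α := ℝ) P.card) c3
  linarith

lemma tendsto_var (H : Hyp μ pX pY X Y) (δ : ℕ) :
    Tendsto (fun m : ℕ => Var[W X Y (Q δ m); μ] / m) atTop
      (nhds ((2 * (δ : ℝ) + 1) * pX * pY * (1 - pX * pY)
              + 2 * (δ : ℝ) * (2 * (δ : ℝ) + 1) * pX * pY
                * (pY * (1 - pX) + pX * (1 - pY)))) := by
  have h1 := tendsto_sum_dg δ (fun x => x ^ 2) (fun a b h => Nat.pow_le_pow_left h 2)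
  have h2 := tendsto_sum_dg δ id monotone_id
  simp only [id, ← card_Q] at h2
  have h := ((h1.const_mul (pX * pY ^ 2 * (1 - pX))).add
    (h1.const_mul (pX ^ 2 * pY * (1 - pY)))).add (h2.const_mul (pX * pY * (1 - pX) * (1 - pY)))
  refine (h.congr fun m => ?_).trans (le_of_eq ?_)
  · rw [H.varW, sum_fst, sum_snd]
    ring
  · congr 1
    push_cast
    ring

/-- The block sums. -/
def B (X Y : ℕ → Ω → ℝ) (δ m k : ℕ) (ω : Ω) : ℝ :=
  ∑ p ∈ Q δ m, X (k * m + p.1) ω * Y (k * m + p.2) ω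

lemma sumB (δ m n : ℕ) (ω : Ω) :
    ∑ k ∈ Finset.range n, B X Y δ m k ω = W X Y (G δ m n) ω := by
  unfold W G B
  rw [Finset.sum_image (G_inj δ m n), Finset.sum_product]

lemma B_zero (δ m : ℕ) : B X Y δ m 0 = W X Y (Q δ m) := by
  ext ω; simp [B, W]

lemma mB (H : Hyp μ pX pY X Y) (δ m k : ℕ) : Measurable (B X Y δ m k) :=
  Finset.measurable_fun_sum _ fun p _ => (H.mX _).mul (H.mY _)

/-- index map -/
def idx (m k : ℕ) : (Finset.Icc 1 m) ⊕ (Finset.Icc 1 m) → ℕ ⊕ ℕ :=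
  Sum.map (fun a => k * m + a) (fun a => k * m + a)

lemma idx_inj (m : ℕ) : Function.Injective
    (fun p : (_ : ℕ) × ((Finset.Icc 1 m) ⊕ (Finset.Icc 1 m)) => idx m p.1 p.2) := by
  rintro ⟨k, ⟨a, ha⟩ | ⟨a, ha⟩⟩ ⟨k', ⟨b, hb⟩ | ⟨b, hb⟩⟩ h
  · simp only [idx, Sum.map_inl, Sum.inl.injEq] at h
    rw [Finset.mem_Icc] at ha hb
    obtain ⟨rfl, rfl⟩ := blk_inj ha.1 ha.2 hb.1 hb.2 h
    rfl
  · simp [idx] at h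
  · simp [idx] at h
  · simp only [idx, Sum.map_inr, Sum.inr.injEq] at h
    rw [Finset.mem_Icc] at ha hb
    obtain ⟨rfl, rfl⟩ := blk_inj ha.1 ha.2 hb.1 hb.2 h
    rfl

/-- the block functional -/
noncomputable def gfun (δ m : ℕ) (v : (Finset.Icc 1 m) ⊕ (Finset.Icc 1 m) → ℝ) : ℝ :=
  ∑ p ∈ Q δ m, (if h : p.1 ∈ Finset.Icc 1 m then v (Sum.inl ⟨p.1, h⟩) else 0)
    * (if h : p.2 ∈ Finset.Icc 1 m then v (Sum.inr ⟨p.2, h⟩) else 0)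

lemma mg (δ m : ℕ) : Measurable (gfun δ m) := by
  refine Finset.measurable_fun_sum _ fun p _ => Measurable.mul ?_ ?_
  · by_cases h : p.1 ∈ Finset.Icc 1 m
    · simp only [h, dif_pos]; fun_prop
    · simp only [h, dif_neg, not_false_eq_true]; fun_prop
  · by_cases h : p.2 ∈ Finset.Icc 1 m
    · simp only [h, dif_pos]; fun_prop
    · simp only [h, dif_neg, not_false_eq_true]; fun_prop

lemma B_eq (δ m k : ℕ) :
    B X Y δ m k = gfun δ m ∘ (fun ω s => Sum.elim X Y (idx m k s) ω) := by
  ext ω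
  simp only [B, gfun, Function.comp]
  refine Finset.sum_congr rfl fun p hp => ?_
  simp only [Q, Finset.mem_filter, Finset.mem_product] at hp
  rw [dif_pos hp.1.1, dif_pos hp.1.2]
  rfl

lemma indepB (H : Hyp μ pX pY X Y) (δ m : ℕ) : iIndepFun (B X Y δ m) μ := by
  have h1 := H.hindep.precomp (idx_inj m)
  have h2 := iIndepFun_blocks (fun k s => Sum.elim X Y (idx m k s)) (fun _ _ => H.mE _) h1
  have h3 := h2.comp (fun _ => gfun δ m) (fun _ => mg δ m)
  have : B X Y δ m = fun k => gfun δ m ∘ (fun ω s => Sum.elim X Y (idx m k s) ω) :=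
    funext fun k => B_eq δ m k
  rw [this]
  exact h3

lemma identB (H : Hyp μ pX pY X Y) (δ m k : ℕ) :
    IdentDistrib (B X Y δ m k) (B X Y δ m 0) μ μ := by
  have hi : ∀ k, iIndepFun (fun s => Sum.elim X Y (idx m k s)) μ := fun k =>
    H.hindep.precomp (g := idx m k) (fun a b hab => by
      have := @idx_inj m ⟨k, a⟩ ⟨k, b⟩ hab
      simpa using this)
  rw [B_eq, B_eq]
  refine IdentDistrib.comp (IdentDistrib.pi (fun s => ?_) (hi k) (hi 0)) (mg δ m)
  rcases s with s | s
  · exact identDistrib_01 (H.mX _) (H.mX _) (H.hX01 _) (H.hX01 _) ((H.hXp _).trans (H.hXp _).symm)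
  · exact identDistrib_01 (H.mY _) (H.mY _) (H.hY01 _) (H.hY01 _) ((H.hYp _).trans (H.hYp _).symm)

lemma main (H : Hyp μ pX pY X Y) (δ : ℕ) (t : ℝ) :
    Tendsto (fun T : ℕ => charFun (μ.map fun ω =>
      (W X Y (Q δ T) ω - ∫ ω', W X Y (Q δ T) ω' ∂μ) / √T) t) atTop
      (nhds (charFun (gaussianReal 0 (Real.toNNReal
            ((2 * (δ : ℝ) + 1) * pX * pY * (1 - pX * pY)
              + 2 * (δ : ℝ) * (2 * (δ : ℝ) + 1) * pX * pY
                * (pY * (1 - pX) + pX * (1 - pY))))) t)) := by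
  have hdec : ∀ m T ω, W X Y (Q δ T) ω
      = W X Y (G δ m (T / m)) ω + W X Y (Q δ T \ G δ m (T / m)) ω := by
    intro m T ω
    unfold W
    rw [add_comm, Finset.sum_sdiff (G_sub δ m T)]
  have hint : ∀ P, Integrable (W X Y P) μ := fun P => (H.memLpW P).integrable (by norm_num)
  have hEG : ∀ m n : ℕ, ∫ ω, W X Y (G δ m n) ω ∂μ = n * ∫ ω, B X Y δ m 0 ω ∂μ := by
    intro m n
    simp only [← sumB]
    rw [integral_finset_sum]
    · simp [(H.identB δ m _).integral_eq]
    · intro k _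
      refine ((H.identB δ m k).integrable_iff).2 ?_
      rw [B_zero]; exact hint _
  have hDA : ∀ m T ω, (W X Y (Q δ T) ω - ∫ ω', W X Y (Q δ T) ω' ∂μ) / √T
      - (∑ k ∈ Finset.range (T / m), B X Y δ m k ω - (T / m : ℕ) * ∫ ω', B X Y δ m 0 ω' ∂μ) / √T
      = (W X Y (Q δ T \ G δ m (T / m)) ω
        - ∫ ω', W X Y (Q δ T \ G δ m (T / m)) ω' ∂μ) / √T := by
    intro m T ω
    rw [← hEG, sumB]
    simp only [hdec m T]
    rw [integral_add (hint _) (hint _)]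
    ring
  refine approx (fun T ω => (W X Y (Q δ T) ω - ∫ ω', W X Y (Q δ T) ω' ∂μ) / √T)
    (fun T => ((H.mW _).sub_const _).div_const _)
    (fun m T ω => (∑ k ∈ Finset.range (T / m), B X Y δ m k ω
      - (T / m : ℕ) * ∫ ω', B X Y δ m 0 ω' ∂μ) / √T)
    (fun m T => ((Finset.measurable_fun_sum _ fun k _ => H.mB δ m k).sub_const _).div_const _)
    (fun m => (Var[W X Y (Q δ m); μ] / m).toNNReal) _
    ((continuous_real_toNNReal.tendsto _).comp (H.tendsto_var δ)) ?_ ?_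
    (3 * (2 * δ + 1) * (2 * δ + 1) ^ 2) (by positivity) ?_ t
  · intro m hm t
    have := clt_blocks (B X Y δ m) (by rw [B_zero]; exact H.memLpW _) (H.indepB δ m)
      (H.identB δ m) m hm t
    rw [B_zero] at this
    rw [B_zero]
    exact this
  · intro m T
    simp only [hDA]
    have : MemLp (fun ω => W X Y (Q δ T \ G δ m (T / m)) ω
        - ∫ ω', W X Y (Q δ T \ G δ m (T / m)) ω' ∂μ) 2 μ := (H.memLpW _).sub (memLp_const _)
    simp only [div_eq_inv_mul]
    exact this.const_mul _
  · intro m hm T hT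
    have hT0 : (0 : ℝ) < T := by exact_mod_cast hT
    have hm0 : (0 : ℝ) < m := by exact_mod_cast hm
    simp only [hDA, div_pow]
    rw [integral_div, Real.sq_sqrt hT0.le,
      ← variance_eq_integral (H.mW _).aemeasurable, div_le_iff₀ hT0]
    refine (H.varW_le δ T _ Finset.sdiff_subset).trans ?_
    have := card_bad δ m T hm
    calc _ ≤ 3 * (2 * (δ : ℝ) + 1) * ((2 * δ + 1) ^ 2 * (m + T / m)) := by gcongr
      _ = _ := by field_simp

end Hyp

end BandCLT

/-- Central limit theorem for the number of marks in a `δ`-band: as `T → ∞` with `δ`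
fixed, the normalized mark count `(|S_{T,δ}| − E(|S_{T,δ}|))/√T` converges in distribution
to a centered Gaussian with variance
`σ_δ² = (2δ+1) p_X p_Y (1 − p_X p_Y) + 2δ(2δ+1) p_X p_Y (p_Y(1 − p_X) + p_X(1 − p_Y))`.
Convergence in distribution is expressed as convergence of the integrals of every bounded
continuous function (weak convergence of the laws). The `X i`, `Y j` (`i, j ≥ 1`) are
mutually independent `{0,1}`-valued random variables, each `X i` Bernoulli(`pX`) and each
`Y j` Bernoulli(`pY`), and `|S_{T,δ}|` counts the pairs `(i, j)` with `1 ≤ i, j ≤ T`,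
`|i − j| ≤ δ` and `X i = Y j = 1`. -/
theorem clt_marks_in_band
    {Ω : Type*} [MeasurableSpace Ω] (μ : Measure Ω) [IsProbabilityMeasure μ]
    (pX pY : ℝ) (hpX : pX ∈ Set.Icc (0 : ℝ) 1) (hpY : pY ∈ Set.Icc (0 : ℝ) 1)
    (δ : ℕ)
    (X Y : ℕ → Ω → ℝ)
    (hXmeas : ∀ i, Measurable (X i)) (hYmeas : ∀ j, Measurable (Y j))
    (hX01 : ∀ i ω, X i ω = 0 ∨ X i ω = 1) (hY01 : ∀ j ω, Y j ω = 0 ∨ Y j ω = 1)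
    (hindep : iIndepFun (m := fun _ : ℕ ⊕ ℕ => Real.measurableSpace) (Sum.elim X Y) μ)
    (hXp : ∀ i, μ {ω | X i ω = 1} = ENNReal.ofReal pX)
    (hYp : ∀ j, μ {ω | Y j ω = 1} = ENNReal.ofReal pY)
    (S : ℕ → Ω → ℝ)
    (hS : ∀ T ω, S T ω
      = ((((Finset.Icc 1 T) ×ˢ (Finset.Icc 1 T)).filter
          (fun p : ℕ × ℕ =>
            ((p.1 : ℤ) - (p.2 : ℤ)).natAbs ≤ δ ∧ X p.1 ω = 1 ∧ Y p.2 ω = 1)).card : ℝ)) :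
    ∀ f : ℝ →ᵇ ℝ,
      Tendsto (fun T : ℕ => ∫ ω, f ((S T ω - ∫ ω', S T ω' ∂μ) / Real.sqrt T) ∂μ) atTop
        (nhds (∫ x, f x
          ∂(gaussianReal 0 (Real.toNNReal
            ((2 * (δ : ℝ) + 1) * pX * pY * (1 - pX * pY)
              + 2 * (δ : ℝ) * (2 * (δ : ℝ) + 1) * pX * pY
                * (pY * (1 - pX) + pX * (1 - pY))))))) := by
  have H : BandCLT.Hyp μ pX pY X Y :=
    ⟨hpX, hpY, hXmeas, hYmeas, hX01, hY01, hindep, hXp, hYp⟩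
  have hSW : ∀ T, S T = BandCLT.W X Y (BandCLT.Q δ T) := by
    intro T
    ext ω
    rw [hS]
    unfold BandCLT.W BandCLT.Q
    rw [Finset.sum_filter, Finset.card_filter]
    push_cast
    refine Finset.sum_congr rfl fun p _ => ?_
    rcases hX01 p.1 ω with h | h <;> rcases hY01 p.2 ω with h' | h' <;> simp [h, h']
  intro f
  simp only [hSW]
  have hm : ∀ T : ℕ, Measurable (fun ω => (BandCLT.W X Y (BandCLT.Q δ T) ω
      - ∫ ω', BandCLT.W X Y (BandCLT.Q δ T) ω' ∂μ) / √T) := fun T =>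
    ((H.mW _).sub_const _).div_const _
  have key := ProbabilityMeasure.tendsto_of_tendsto_charFun
    (μ := fun T : ℕ => (⟨μ.map (fun ω => (BandCLT.W X Y (BandCLT.Q δ T) ω
      - ∫ ω', BandCLT.W X Y (BandCLT.Q δ T) ω' ∂μ) / √T),
        Measure.isProbabilityMeasure_map (hm T).aemeasurable⟩ : ProbabilityMeasure ℝ))
    (μ₀ := ⟨gaussianReal 0 (Real.toNNReal
            ((2 * (δ : ℝ) + 1) * pX * pY * (1 - pX * pY)
              + 2 * (δ : ℝ) * (2 * (δ : ℝ) + 1) * pX * pY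
                * (pY * (1 - pX) + pX * (1 - pY)))), inferInstance⟩)
    (fun t => H.main δ t)
  have := ProbabilityMeasure.tendsto_iff_forall_integral_tendsto.1 key f
  refine this.congr fun T => ?_
  exact integral_map (hm T).aemeasurable f.continuous.aestronglyMeasurable
end
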